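/- Let Φ ∈ ℝ^{M×N} have columns φ₁,…,φ_N, let x ∈ ℝ^N have support T with |T| = K ≥ 1, and let y = Φx. Let S ⊆ {1,…,N} be a support estimate with n_c = |S ∩ T|, n_f = |S ∖ T|, and suppose T is not contained in S (so n_c < K). Let r be a least-squares residual of y on S. If Φ satisfies the restricted isometry property of order K + n_f + 1 with constant δ < 1/(√(K − n_c) + 1), then r ≠ 0 and every index t maximizing |⟨φ_i, r⟩| over i ∈ {1,…,N} belongs to T ∖ S; that is, the next OMP iteration selects a correct, previously unselected index. -/

import Mathlib

open Finset

/-- The Euclidean (ℓ²) norm of a vector in ℝⁿ. -/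
noncomputable def l2norm {n : ℕ} (v : Fin n → ℝ) : ℝ := Real.sqrt (∑ i, v i ^ 2)

/-- The Euclidean inner product on ℝᵐ. -/
noncomputable def dot {m : ℕ} (u v : Fin m → ℝ) : ℝ := ∑ k, u k * v k

/-- `x` has at most `s` nonzero entries. -/
noncomputable def sparse {n : ℕ} (s : ℕ) (x : Fin n → ℝ) : Prop :=
  (Finset.univ.filter (fun i => x i ≠ 0)).card ≤ s

/-- `Φ` satisfies the restricted isometry property of order `s` with constant `δ`. -/
noncomputable def RIP {M N : ℕ} (Φ : Matrix (Fin M) (Fin N) ℝ) (s : ℕ) (δ : ℝ) : Prop :=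
  ∀ x : Fin N → ℝ, sparse s x →
    (1 - δ) * l2norm x ^ 2 ≤ l2norm (Φ.mulVec x) ^ 2 ∧
    l2norm (Φ.mulVec x) ^ 2 ≤ (1 + δ) * l2norm x ^ 2

lemma l2norm_sq_aux {n : ℕ} (v : Fin n → ℝ) : l2norm v ^ 2 = ∑ i, v i ^ 2 := by
  unfold l2norm
  exact Real.sq_sqrt (Finset.sum_nonneg fun i _ => sq_nonneg _)

lemma dot_mulVec_aux {M N : ℕ} (Φ : Matrix (Fin M) (Fin N) ℝ) (z : Fin N → ℝ)
    (r : Fin M → ℝ) :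
    ∑ k, Φ.mulVec z k * r k = ∑ i, z i * dot (fun k => Φ k i) r := by
  simp only [Matrix.mulVec, dotProduct, dot, Finset.sum_mul, Finset.mul_sum]
  rw [Finset.sum_comm]
  refine Finset.sum_congr rfl fun i _ => Finset.sum_congr rfl fun k _ => ?_
  ring

/-- Perturbing by a multiple of a coordinate vector. -/
lemma expand_aux {M N : ℕ} (Φ : Matrix (Fin M) (Fin N) ℝ) (z : Fin N → ℝ)
    (t : Fin N) (a : ℝ) :
    l2norm (Φ.mulVec (z + a • Pi.single t 1)) ^ 2 =
      l2norm (Φ.mulVec z) ^ 2 + 2 * a * dot (fun k => Φ k t) (Φ.mulVec z)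
        + a ^ 2 * ∑ k, Φ k t ^ 2 := by
  rw [l2norm_sq_aux, l2norm_sq_aux, dot, Finset.mul_sum, Finset.mul_sum,
    ← Finset.sum_add_distrib, ← Finset.sum_add_distrib]
  refine Finset.sum_congr rfl fun k _ => ?_
  rw [Matrix.mulVec_add, Matrix.mulVec_smul, Matrix.mulVec_single_one]
  simp only [Pi.add_apply, Pi.smul_apply, smul_eq_mul, Matrix.col_apply]
  ring

lemma norm_aux {N : ℕ} (z : Fin N → ℝ) (t : Fin N) (hz : z t = 0) (a : ℝ) :
    l2norm (z + a • Pi.single t 1) ^ 2 = l2norm z ^ 2 + a ^ 2 := by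
  rw [l2norm_sq_aux, l2norm_sq_aux]
  have : ∀ i, (z + a • Pi.single t (1 : ℝ) : Fin N → ℝ) i ^ 2 = z i ^ 2 + if i = t then a ^ 2 else 0 := by
    intro i
    by_cases h : i = t
    · subst h; simp [hz]
    · simp [h]
  simp only [this, Finset.sum_add_distrib]
  simp

/-- Near-orthogonality of a column outside the support. -/
lemma col_bound_aux {M N : ℕ} (Φ : Matrix (Fin M) (Fin N) ℝ) (s : ℕ) (δ : ℝ) (hδ0 : 0 < δ)
    (hRIP : RIP Φ s δ) (z : Fin N → ℝ) (U : Finset (Fin N)) (hU : ∀ i, z i ≠ 0 → i ∈ U)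
    (hcard : U.card + 1 ≤ s) (t : Fin N) (hz : z t = 0) :
    dot (fun k => Φ k t) (Φ.mulVec z) ^ 2 ≤ δ ^ 2 * l2norm z ^ 2 := by
  have hsp : ∀ a : ℝ, sparse s (z + a • Pi.single t 1) := by
    intro a
    refine le_trans (Finset.card_le_card (t := insert t U) ?_)
      ((Finset.card_insert_le _ _).trans hcard)
    intro i hi
    by_cases h : i = t
    · simp [h]
    · have : z i ≠ 0 := by simpa [h] using hi
      simp [hU i this]
  set p := dot (fun k => Φ k t) (Φ.mulVec z) with hp
  have h1 := (hRIP _ (hsp (p / δ))).2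
  have h2 := (hRIP _ (hsp (-(p / δ)))).1
  rw [expand_aux, norm_aux z t hz, ← hp] at h1 h2
  have h3 : 2 * (p / δ) * p ≤ δ * (l2norm z ^ 2 + (p / δ) ^ 2) := by nlinarith
  obtain ⟨a, ha⟩ : ∃ a, a = p / δ := ⟨_, rfl⟩
  have hpa : p = a * δ := by rw [ha]; field_simp
  rw [← ha, hpa] at h3
  rw [hpa]
  nlinarith [mul_le_mul_of_nonneg_left h3 hδ0.le]

/-- Theorem 2, success of a single OMP iteration:
let `x` be `K`-sparse with support `T` (`K ≥ 1`), `y = Φx`, `S` a support estimate with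
`n_c = |S ∩ T|`, `n_f = |S ∖ T|` and `T ⊄ S`, and let `r = y − Φx̃` be a least-squares
residual of `y` on `S`.  If `Φ` has RIP of order `K + n_f + 1` with constant
`δ < 1/(√(K−n_c)+1)`, then `r ≠ 0` and every index `t` maximizing `|⟨φ_i, r⟩|`
belongs to `T ∖ S`. -/
theorem stmt_8 {M N : ℕ} (K : ℕ) (hK : 1 ≤ K)
    (Φ : Matrix (Fin M) (Fin N) ℝ)
    (x : Fin N → ℝ) (T : Finset (Fin N))
    (hT : ∀ i, x i ≠ 0 ↔ i ∈ T) (hTcard : T.card = K)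
    (y : Fin M → ℝ) (hy : y = Φ.mulVec x)
    (S : Finset (Fin N)) (hTS : ¬ T ⊆ S)
    (xt : Fin N → ℝ) (hxt : ∀ i, xt i ≠ 0 → i ∈ S)
    (r : Fin M → ℝ) (hr : r = y - Φ.mulVec xt)
    (horth : ∀ i ∈ S, dot (fun k => Φ k i) r = 0)
    (δ : ℝ) (hδ0 : 0 < δ)
    (hδ : δ < 1 / (Real.sqrt ((K : ℝ) - ((S ∩ T).card : ℝ)) + 1))
    (hRIP : RIP Φ (K + (S \ T).card + 1) δ) :
    r ≠ 0 ∧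
    ∀ t : Fin N,
      (∀ i : Fin N, |dot (fun k => Φ k i) r| ≤ |dot (fun k => Φ k t) r|) →
      t ∈ T \ S := by
  subst hy
  obtain ⟨z, hzdef⟩ : ∃ z, z = x - xt := ⟨_, rfl⟩
  have hrz : r = Φ.mulVec z := by rw [hr, hzdef, Matrix.mulVec_sub]
  have hU : ∀ i, z i ≠ 0 → i ∈ T ∪ S := by
    intro i hi
    by_contra hn
    rw [Finset.mem_union, not_or] at hn
    have h1 : x i = 0 := by
      by_contra h; exact hn.1 ((hT i).1 h)
    have h2 : xt i = 0 := by
      by_contra h; exact hn.2 (hxt i h)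
    exact hi (by simp [hzdef, h1, h2])
  have hUcard : (T ∪ S).card + 1 ≤ K + (S \ T).card + 1 := by
    rw [← Finset.union_sdiff_self_eq_union, ← hTcard]
    have := Finset.card_union_le T (S \ T)
    omega
  obtain ⟨j, hjT, hjS⟩ := Finset.not_subset.1 hTS
  have hzj : z j ≠ 0 := by
    have h2 : xt j = 0 := by
      by_contra h; exact hjS (hxt j h)
    simpa [hzdef, h2] using (hT j).2 hjT
  have hZ : 0 < l2norm z ^ 2 := by
    rw [l2norm_sq_aux]
    exact Finset.sum_pos' (fun i _ => sq_nonneg _) ⟨j, Finset.mem_univ _, by positivity⟩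
  have hL : (K : ℝ) - ((S ∩ T).card : ℝ) = ((T \ S).card : ℝ) := by
    have := Finset.card_sdiff_add_card_inter T S
    rw [Finset.inter_comm, hTcard] at this
    rw [← this]; push_cast; ring
  rw [hL] at hδ
  obtain ⟨q, hq⟩ : ∃ q, q = Real.sqrt ((T \ S).card : ℝ) := ⟨_, rfl⟩
  have hq0 : 0 ≤ q := hq ▸ Real.sqrt_nonneg _
  have hq2 : q ^ 2 = ((T \ S).card : ℝ) := by
    rw [hq]; exact Real.sq_sqrt (Nat.cast_nonneg _)
  rw [← hq, lt_div_iff₀ (by positivity)] at hδ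
  have hδ1 : 0 < 1 - δ := by nlinarith [mul_nonneg hδ0.le hq0]
  have hsp : sparse (K + (S \ T).card + 1) z := by
    refine le_trans (Finset.card_le_card (t := T ∪ S) ?_) (by omega)
    intro i hi
    exact hU i (by simpa using hi)
  have hlow := (hRIP z hsp).1
  rw [← hrz] at hlow
  have hR : 0 < l2norm r ^ 2 := lt_of_lt_of_le (mul_pos hδ1 hZ) hlow
  have hne : r ≠ 0 := by
    intro h
    rw [l2norm_sq_aux, h] at hR
    simp at hR
  refine ⟨hne, fun t ht => ?_⟩
  by_contra htn
  -- the key Cauchy-Schwarz bound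
  have hsum : l2norm r ^ 2 = ∑ i ∈ T \ S, z i * dot (fun k => Φ k i) r := by
    have h1 : l2norm r ^ 2 = ∑ i, z i * dot (fun k => Φ k i) r := by
      rw [← dot_mulVec_aux, l2norm_sq_aux, ← hrz]
      exact Finset.sum_congr rfl fun k _ => by ring
    rw [h1]
    symm
    refine Finset.sum_subset (Finset.subset_univ _) fun i _ hi => ?_
    by_cases hiS : i ∈ S
    · rw [horth i hiS, mul_zero]
    · have : z i = 0 := by
        by_contra h
        have := hU i h
        simp_all
      rw [this, zero_mul]
  have hcs : (l2norm r ^ 2) ^ 2 ≤ l2norm z ^ 2 * (q ^ 2 * dot (fun k => Φ k t) r ^ 2) := by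
    rw [hsum]
    refine (Finset.sum_mul_sq_le_sq_mul_sq _ _ _).trans ?_
    refine mul_le_mul ?_ ?_ (Finset.sum_nonneg fun i _ => sq_nonneg _) hZ.le
    · rw [l2norm_sq_aux]
      exact Finset.sum_le_sum_of_subset_of_nonneg (Finset.subset_univ _)
        fun i _ _ => sq_nonneg _
    · rw [hq2, ← nsmul_eq_mul]
      exact Finset.sum_le_card_nsmul _ _ _ fun i _ => sq_le_sq.2 (ht i)
  by_cases htS : t ∈ S
  · rw [horth t htS] at hcs
    nlinarith [pow_pos hR 2]
  · have hzt : z t = 0 := by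
      by_contra h
      have := hU t h
      simp_all
    have hb := col_bound_aux Φ _ δ hδ0 hRIP z (T ∪ S) hU hUcard t hzt
    rw [← hrz] at hb
    have h5 : (l2norm r ^ 2) ^ 2 ≤ (q * δ * l2norm z ^ 2) ^ 2 := by
      refine hcs.trans ?_
      have := mul_le_mul_of_nonneg_left hb (mul_nonneg hZ.le (sq_nonneg q))
      nlinarith
    have h6 := (abs_le_of_sq_le_sq' h5 (by positivity)).2
    have h7 : q * δ * l2norm z ^ 2 < (1 - δ) * l2norm z ^ 2 :=
      mul_lt_mul_of_pos_right (by linarith) hZ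
    linarith
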